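/- Let K be a CW complex and let ν, σ, τ be cells of K such that ν is a regular facet of σ and σ is a regular facet of τ. Then there exists a cell σ̃ ≠ σ of K such that ν is a facet of σ̃ and σ̃ is a facet of τ. -/

import Mathlib

/-!
Set-based CW complexes: a CW complex is identified with the family of its cells.
Each `n`-cell `τ` has a characteristic map `charMap τ : D^n → X` (from the closed
unit disk of `EuclideanSpace ℝ (Fin n)`), the open cells partition `X`, the closure
of each cell is the image of the closed disk, the boundary sphere is mapped into
finitely many cells of strictly lower dimension (closure finiteness), and `X`
carries the weak topology determined by the closed cells.
-/

open Metric Set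

structure CWComplexCells (X : Type) [TopologicalSpace X] [T2Space X] where
  /-- The (index type of the) cells of the complex. -/
  Cell : Type
  /-- The dimension of each cell. -/
  dim : Cell → ℕ
  /-- The characteristic map of each cell. -/
  charMap : (τ : Cell) → EuclideanSpace ℝ (Fin (dim τ)) → X
  charMap_continuousOn : ∀ τ, ContinuousOn (charMap τ) (closedBall 0 1)
  charMap_injOn : ∀ τ, InjOn (charMap τ) (ball 0 1)
  /-- Distinct (open) cells are disjoint. -/
  cells_disjoint : ∀ σ τ : Cell, σ ≠ τ →
    Disjoint (charMap σ '' ball 0 1) (charMap τ '' ball 0 1)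
  /-- The open cells cover the space. -/
  cells_cover : (⋃ τ : Cell, charMap τ '' ball 0 1) = univ
  /-- The closure of an open cell is the image of the closed disk. -/
  closure_cell : ∀ τ, closure (charMap τ '' ball 0 1) = charMap τ '' closedBall 0 1
  /-- Closure finiteness: the boundary sphere of each cell is mapped into a finite
  union of cells of strictly smaller dimension. -/
  sphere_subset : ∀ τ, ∃ I : Set Cell, I.Finite ∧ (∀ σ ∈ I, dim σ < dim τ) ∧
    charMap τ '' sphere 0 1 ⊆ ⋃ σ ∈ I, charMap σ '' ball 0 1
  /-- Weak topology: a set is closed iff its intersection with each closed cell is closed. -/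
  isClosed_iff : ∀ A : Set X, IsClosed A ↔ ∀ τ, IsClosed (A ∩ charMap τ '' closedBall 0 1)

namespace CWComplexCells

variable {X : Type} [TopologicalSpace X] [T2Space X] (K : CWComplexCells X)

/-- The (open) cell of `τ`, as a subset of the space. -/
def cellSet (τ : K.Cell) : Set X := K.charMap τ '' ball 0 1

/-- `ν` is a face of `τ` (written `ν < τ`): `ν ⊆ cl(τ) \ τ`. -/
def Face (ν τ : K.Cell) : Prop :=
  K.cellSet ν ⊆ closure (K.cellSet τ) \ K.cellSet τ

/-- `ν` is a facet of `τ` (written `ν ≺ τ`): a face of codimension one. -/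
def Facet (ν τ : K.Cell) : Prop := K.Face ν τ ∧ K.dim ν + 1 = K.dim τ

/-- The preimage of the cell `σ` under the characteristic map of `τ`,
inside the closed disk. -/
def preim (σ τ : K.Cell) : Set (EuclideanSpace ℝ (Fin (K.dim τ))) :=
  closedBall 0 1 ∩ K.charMap τ ⁻¹' K.cellSet σ

/-- `σ` is a regular face of `τ`: `σ < τ`, the restriction
`charMap τ : charMap τ ⁻¹(σ) → σ` is a homeomorphism, and the closure of
`charMap τ ⁻¹(σ)` is a closed `(dim σ)`-ball. -/
def RegularFace (σ τ : K.Cell) : Prop :=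
  K.Face σ τ ∧
  (∃ e : K.preim σ τ ≃ₜ K.cellSet σ,
    ∀ x : K.preim σ τ, (e x : X) = K.charMap τ (x : EuclideanSpace ℝ (Fin (K.dim τ)))) ∧
  Nonempty ((closure (K.preim σ τ)) ≃ₜ
    (closedBall (0 : EuclideanSpace ℝ (Fin (K.dim σ))) 1))

/-- `σ` is an irregular face of `τ`. -/
def IrregularFace (σ τ : K.Cell) : Prop := K.Face σ τ ∧ ¬ K.RegularFace σ τ

/-- `σ` is a regular facet of `τ`. -/
def RegularFacet (σ τ : K.Cell) : Prop := K.RegularFace σ τ ∧ K.dim σ + 1 = K.dim τ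

/-- `σ` is an irregular facet of `τ`. -/
def IrregularFacet (σ τ : K.Cell) : Prop := K.Facet σ τ ∧ ¬ K.RegularFace σ τ

/-- The set of upper noncritical neighbours of `σ`:
`(k+1)`-cells `τ` with `σ ≺ τ` and `f σ ≥ f τ`. -/
def Uset (f : K.Cell → ℝ) (σ : K.Cell) : Set K.Cell :=
  {τ | K.Facet σ τ ∧ f σ ≥ f τ}

/-- The set of lower noncritical neighbours of `σ`:
`(k-1)`-cells `ν` with `ν ≺ σ` and `f ν ≥ f σ`. -/
def Dset (f : K.Cell → ℝ) (σ : K.Cell) : Set K.Cell :=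
  {ν | K.Facet ν σ ∧ f ν ≥ f σ}

/-- `U(σ)`. -/
noncomputable def U (f : K.Cell → ℝ) (σ : K.Cell) : ℕ∞ := (K.Uset f σ).encard

/-- `D(σ)`. -/
noncomputable def D (f : K.Cell → ℝ) (σ : K.Cell) : ℕ∞ := (K.Dset f σ).encard

/-- `f` is a discrete Morse function. -/
def DiscreteMorse (f : K.Cell → ℝ) : Prop :=
  ∀ σ : K.Cell,
    (∀ τ, K.IrregularFacet σ τ → f σ < f τ) ∧
    K.U f σ ≤ 1 ∧
    (∀ ν, K.IrregularFacet ν σ → f ν < f σ) ∧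
    K.D f σ ≤ 1

/-- Two cells are adjacent if one is a facet of the other. -/
def Adjacent (σ τ : K.Cell) : Prop := K.Facet σ τ ∨ K.Facet τ σ

/-- There is an `r`-path from `σ` to `τ`: a sequence of cells on the level set
`f⁻¹(r)` in which consecutive cells are facets of one another. -/
def RPath (f : K.Cell → ℝ) (r : ℝ) (σ τ : K.Cell) : Prop :=
  f σ = r ∧ Relation.ReflTransGen (fun a b => K.Adjacent a b ∧ f b = r) σ τ

/-- A family of cells contained in one level set of `f` whose members are
pairwise joined by `c`-paths. -/
def IsPreCollection (f : K.Cell → ℝ) (C : Set K.Cell) : Prop :=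
  ∃ c : ℝ, (∀ σ ∈ C, f σ = c) ∧ ∀ σ ∈ C, ∀ τ ∈ C, K.RPath f c σ τ

/-- A collection for `f`: a maximal family of cells contained in one level set
of `f` whose members are pairwise joined by `c`-paths. -/
def IsCollection (f : K.Cell → ℝ) (C : Set K.Cell) : Prop :=
  K.IsPreCollection f C ∧ ∀ C', C ⊆ C' → K.IsPreCollection f C' → C' = C

/-- The set counted by `U^C(σ)`. -/
def UCset (f : K.Cell → ℝ) (C : Set K.Cell) (σ : K.Cell) : Set K.Cell :=
  {τ | τ ∉ C ∧ K.Facet σ τ ∧ f σ ≥ f τ}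

/-- The set counted by `D^C(σ)`. -/
def DCset (f : K.Cell → ℝ) (C : Set K.Cell) (σ : K.Cell) : Set K.Cell :=
  {ν | ν ∉ C ∧ K.Facet ν σ ∧ f ν ≥ f σ}

/-- `U^C(σ)`. -/
noncomputable def UC (f : K.Cell → ℝ) (C : Set K.Cell) (σ : K.Cell) : ℕ∞ :=
  (K.UCset f C σ).encard

/-- `D^C(σ)`. -/
noncomputable def DC (f : K.Cell → ℝ) (C : Set K.Cell) (σ : K.Cell) : ℕ∞ :=
  (K.DCset f C σ).encard

/-- `f` is a discrete Morse–Bott function. -/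
def DiscreteMorseBott (f : K.Cell → ℝ) : Prop :=
  ∀ C : Set K.Cell, K.IsCollection f C → ∀ σ ∈ C,
    (∀ τ, K.IrregularFace σ τ → f σ < f τ) ∧
    K.UC f C σ ≤ 1 ∧
    (∀ ν, K.IrregularFace ν σ → f ν < f σ) ∧
    K.DC f C σ ≤ 1

/-- The reduced collection `C^red`: delete from `C` all upward noncritical cells
(those with `U^C(σ) = 1`) and all downward noncritical cells (those with `D^C(σ) = 1`). -/
def red (f : K.Cell → ℝ) (C : Set K.Cell) : Set K.Cell :=
  {σ ∈ C | K.UC f C σ ≠ 1 ∧ K.DC f C σ ≠ 1}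

end CWComplexCells

/-- Interpolation of `det` along the segment from `1` to `A`. -/
lemma aux_det_interp {ι : Type*} [Fintype ι] [DecidableEq ι] (s : Finset ℝ)
    (hs : Fintype.card ι < s.card) (A : Matrix ι ι ℝ) :
    A.det = ∑ t ∈ s, (Lagrange.basis s id t).eval 1 * ((1 - t) • (1 : Matrix ι ι ℝ) + t • A).det := by
  classical
  set P : Polynomial ℝ := Matrix.det ((Polynomial.X : Polynomial ℝ) • (A - 1).map Polynomial.C
    + (1 : Matrix ι ι ℝ).map Polynomial.C) with hP
  have hdeg : P.degree < s.card := by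
    refine lt_of_le_of_lt Polynomial.degree_le_natDegree ?_
    have := Polynomial.natDegree_det_X_add_C_le (A - 1) (1 : Matrix ι ι ℝ)
    exact_mod_cast lt_of_le_of_lt this hs
  have hev : ∀ t : ℝ, P.eval t = ((1 - t) • (1 : Matrix ι ι ℝ) + t • A).det := by
    intro t
    rw [hP, ← Polynomial.coe_evalRingHom, RingHom.map_det]
    congr 1
    ext i j
    by_cases hij : i = j
    · subst hij; simp [Matrix.add_apply, Matrix.sub_apply]; ring
    · simp [Matrix.add_apply, Matrix.sub_apply, Matrix.one_apply_ne hij]; ring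
  have h := Lagrange.eq_interpolate (v := id) (s := s) (f := P) (injOn_id _) hdeg
  have h1 := congrArg (Polynomial.eval 1) h
  rw [hev 1, Lagrange.interpolate_apply, Polynomial.eval_finsetSum] at h1
  simp only [sub_self, zero_smul, one_smul, zero_add] at h1
  rw [h1]
  refine Finset.sum_congr rfl fun t _ => ?_
  rw [Polynomial.eval_mul, Polynomial.eval_C, hev]
  simp [mul_comm]

lemma aux_sum_basis (s : Finset ℝ) (hs : s.Nonempty) :
    ∑ t ∈ s, (Lagrange.basis s id t).eval (1:ℝ) = 1 := by
  have := congrArg (Polynomial.eval (1:ℝ)) (Lagrange.sum_basis (s := s) (v := id) (injOn_id _) hs)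
  simpa [Polynomial.eval_finsetSum] using this

lemma aux_clm_det_interp {E : Type*} [NormedAddCommGroup E] [InnerProductSpace ℝ E]
    [FiniteDimensional ℝ E]
    (s : Finset ℝ) (hs : Module.finrank ℝ E < s.card)
    (A : E →L[ℝ] E) :
    A.det = ∑ t ∈ s, (Lagrange.basis s id t).eval 1 *
      ((1 - t) • ContinuousLinearMap.id ℝ (E) + t • A).det := by
  set b := Module.finBasis ℝ E
  have h := aux_det_interp s (by simpa using hs) (LinearMap.toMatrix b b A.toLinearMap)
  have key : ∀ B : E →L[ℝ] E,
      B.det = (LinearMap.toMatrix b b B.toLinearMap).det := fun B =>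
    (LinearMap.det_toMatrix b _).symm
  rw [key, h]
  refine Finset.sum_congr rfl fun t _ => ?_
  rw [key]
  congr 2
  simp

/-- Milnor–Rogers: there is no `C¹` retraction of the ball onto the sphere. -/
lemma aux_no_smooth_retraction {E : Type*} [NormedAddCommGroup E] [InnerProductSpace ℝ E]
    [FiniteDimensional ℝ E] [MeasurableSpace E] [BorelSpace E]
    (r : E → E) (hr : ContDiff ℝ 1 r) (R : ℝ)
    (hR : 0 < R) (hnorm : ∀ x, ‖r x‖ = R) (hid : ∀ x, ‖x‖ = R → r x = x) : False := by
  have hdiff : Differentiable ℝ r := hr.differentiable (by norm_num)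
  have hcont : Continuous (fderiv ℝ r) := hr.continuous_fderiv (by norm_num)
  -- the family
  let L : ℝ → E → (E →L[ℝ] E) := fun t x => (1 - t) • ContinuousLinearMap.id ℝ E + t • fderiv ℝ r x
  let f : ℝ → E → E := fun t x => (1 - t) • x + t • r x
  have hfL : ∀ t x, HasStrictFDerivAt (f t) (L t x) x := by
    intro t x
    have h1 : HasStrictFDerivAt r (fderiv ℝ r x) x := hr.contDiffAt.hasStrictFDerivAt (by norm_num)
    exact ((hasStrictFDerivAt_id x).const_smul (1 - t)).add (h1.const_smul t)
  have hLcont : Continuous fun p : ℝ × E => (L p.1 p.2).det := by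
    refine ContinuousLinearMap.continuous_det.comp ?_
    fun_prop
  have hpos : ∀ᶠ t in nhds (0:ℝ), ∀ x ∈ closedBall (0:E) R, 0 < (L t x).det := by
    refine (isCompact_closedBall (0:E) R).eventually_forall_of_forall_eventually
      (P := fun t x => 0 < (L t x).det) ?_
    intro x _
    refine hLcont.continuousAt.eventually_const_lt ?_
    simp [L, ContinuousLinearMap.det]
  obtain ⟨C, hC⟩ := (isCompact_closedBall (0:E) R).exists_bound_of_continuousOn hcont.continuousOn
  have hlip : ∀ x ∈ closedBall (0:E) R, ∀ y ∈ closedBall (0:E) R, ‖r y - r x‖ ≤ C * ‖y - x‖ :=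
    fun x hx y hy => (convex_closedBall (0:E) R).norm_image_sub_le_of_norm_fderiv_le
      (fun z _ => hdiff z) hC hx hy
  have hinjev : ∀ᶠ t in nhds (0:ℝ), |t| * (1 + |C|) < 1 := by
    have : Continuous fun t : ℝ => |t| * (1 + |C|) := by fun_prop
    exact this.continuousAt.eventually_lt continuousAt_const (by simp)
  have hinj : ∀ t, |t| * (1 + |C|) < 1 → InjOn (f t) (closedBall (0:E) R) := by
    intro t ht x hx y hy hxy
    by_contra hne
    have h1 : y - x = t • ((y - x) - (r y - r x)) := by
      have : (1 - t) • x + t • r x = (1 - t) • y + t • r y := hxy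
      have h2 : (1 - t) • y + t • r y - ((1 - t) • x + t • r x) = 0 := by rw [this, sub_self]
      rw [← sub_eq_zero, ← h2]
      module
    have hn : 0 < ‖y - x‖ := norm_pos_iff.2 (sub_ne_zero.2 (Ne.symm hne))
    have h3 : ‖y - x‖ ≤ |t| * (‖y - x‖ + |C| * ‖y - x‖) := by
      calc ‖y - x‖ = |t| * ‖(y - x) - (r y - r x)‖ := by
            conv_lhs => rw [h1]
            rw [norm_smul, Real.norm_eq_abs]
        _ ≤ |t| * (‖y - x‖ + |C| * ‖y - x‖) := by
            gcongr
            refine (norm_sub_le _ _).trans ?_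
            gcongr
            exact (hlip x hx y hy).trans (by gcongr; exact le_abs_self C)
    nlinarith
  -- for small `t ∈ [0, δ)` the image of the ball is the ball
  have hnormf : ∀ t, 0 ≤ t → t < 1 → ∀ x ∈ ball (0:E) R, f t x ∈ ball (0:E) R := by
    intro t h0 h1 x hx
    rw [mem_ball_zero_iff] at hx ⊢
    calc ‖f t x‖ ≤ ‖(1 - t) • x‖ + ‖t • r x‖ := norm_add_le _ _
      _ = (1 - t) * ‖x‖ + t * R := by
          rw [norm_smul, norm_smul, hnorm, Real.norm_of_nonneg h0,
            Real.norm_of_nonneg (by linarith)]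
      _ < R := by nlinarith
  have himage : ∀ t, 0 ≤ t → t < 1 → (∀ x ∈ closedBall (0:E) R, 0 < (L t x).det) →
      f t '' ball (0:E) R = ball (0:E) R := by
    intro t h0 h1 hdet
    refine Subset.antisymm (image_subset_iff.2 (hnormf t h0 h1)) ?_
    have hfc : Continuous (f t) :=
      (continuous_id.const_smul (1 - t)).add (hdiff.continuous.const_smul t)
    refine (convex_ball (0:E) R).isPreconnected.subset_of_closure_inter_subset ?_ ?_ ?_
    · rw [isOpen_iff_mem_nhds]
      rintro _ ⟨x, hx, rfl⟩
      have hne := (hdet x (ball_subset_closedBall hx)).ne'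
      have hsurj : (L t x).toLinearMap.range = ⊤ := by
        have := ((L t x).toLinearMap.equivOfDetNeZero hne).range
        rwa [LinearMap.equivOfDetNeZero, LinearEquiv.coe_ofIsUnitDet] at this
      rw [← (hfL t x).map_nhds_eq_of_surj hsurj]
      exact Filter.image_mem_map (isOpen_ball.mem_nhds hx)
    · exact ⟨f t 0, hnormf t h0 h1 0 (mem_ball_self hR), 0, mem_ball_self hR, rfl⟩
    · rintro y ⟨hy, hyb⟩
      have hcl : closure (f t '' ball (0:E) R) ⊆ f t '' closedBall (0:E) R :=
        closure_minimal (image_mono ball_subset_closedBall)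
          ((isCompact_closedBall (0:E) R).image hfc).isClosed
      obtain ⟨x, hx, rfl⟩ := hcl hy
      refine ⟨x, ?_, rfl⟩
      rw [mem_ball_zero_iff]
      rw [mem_closedBall_zero_iff] at hx
      refine lt_of_le_of_ne hx fun hxR => ?_
      have : f t x = x := by
        simp only [f, hid x hxR]; module
      rw [this, mem_ball_zero_iff] at hyb
      exact hyb.ne hxR
  obtain ⟨δ, hδ, hδP⟩ := Metric.eventually_nhds_iff.1 (hpos.and hinjev)
  -- nodes
  have hint : ∀ t, 0 ≤ t → t < 1 → t < δ →
      ∫ x in ball (0:E) R, (L t x).det = MeasureTheory.volume.real (ball (0:E) R) := by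
    intro t h0 h1 h2
    obtain ⟨hd, hi⟩ := hδP (y := t) (by simpa [abs_of_nonneg h0] using h2)
    have := MeasureTheory.integral_image_eq_integral_abs_det_fderiv_smul MeasureTheory.volume
      (s := ball (0:E) R) (f := f t) (f' := L t) measurableSet_ball
      (fun x _ => (hfL t x).hasFDerivAt.hasFDerivWithinAt)
      ((hinj t hi).mono ball_subset_closedBall) (fun _ => (1:ℝ))
    rw [himage t h0 h1 hd] at this
    simp only [smul_eq_mul, mul_one, MeasureTheory.integral_const, MeasurableSet.univ,
      MeasureTheory.measureReal_restrict_apply, univ_inter] at this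
    rw [this]
    refine MeasureTheory.setIntegral_congr_fun measurableSet_ball fun x hx => ?_
    exact (abs_of_pos (hd x (ball_subset_closedBall hx))).symm
  obtain ⟨s, hs, hcard⟩ := (Ioo_infinite (show (0:ℝ) < min 1 δ by positivity)).exists_subset_card_eq
    (Module.finrank ℝ E + 1)
  have hA : ∀ x, (fderiv ℝ r x).det = 0 := by
    intro x
    by_contra hne
    have hsurj : Function.Surjective (fderiv ℝ r x) := by
      have := ((fderiv ℝ r x).toLinearMap.equivOfDetNeZero hne).surjective
      rwa [LinearMap.equivOfDetNeZero, ← LinearEquiv.coe_coe, LinearEquiv.coe_ofIsUnitDet] at this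
    obtain ⟨v, hv⟩ := hsurj (r x)
    have hconst : HasFDerivAt (fun y => ‖r y‖ ^ 2) (0 : E →L[ℝ] ℝ) x := by
      simp only [hnorm]
      exact hasFDerivAt_const _ _
    have h2 := (hdiff x).hasFDerivAt.norm_sq
    have h3 := DFunLike.congr_fun (h2.unique hconst) v
    have h4 := hnorm x
    simp [hv] at h3
    rw [h3] at h4
    simp at h4
    exact hR.ne h4
  have hfin : ∫ x in ball (0:E) R, (fderiv ℝ r x).det = MeasureTheory.volume.real (ball (0:E) R) := by
    have hci : ∀ t, MeasureTheory.IntegrableOn (fun x => (L t x).det) (ball (0:E) R) := by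
      intro t
      have hc : Continuous fun x => (L t x).det := hLcont.comp (by fun_prop : Continuous fun x => (t, x))
      exact (hc.continuousOn.integrableOn_compact (isCompact_closedBall (0:E) R)).mono_set
        ball_subset_closedBall
    calc ∫ x in ball (0:E) R, (fderiv ℝ r x).det
        = ∫ x in ball (0:E) R, ∑ t ∈ s, (Lagrange.basis s id t).eval 1 * (L t x).det := by
          congr 1; ext x; exact aux_clm_det_interp s (by omega) _
      _ = ∑ t ∈ s, (Lagrange.basis s id t).eval 1 * ∫ x in ball (0:E) R, (L t x).det := by
          rw [MeasureTheory.integral_finsetSum _ fun t _ => (hci t).const_mul _]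
          simp_rw [MeasureTheory.integral_const_mul]
      _ = ∑ t ∈ s, (Lagrange.basis s id t).eval 1 * MeasureTheory.volume.real (ball (0:E) R) := by
          refine Finset.sum_congr rfl fun t ht => ?_
          have := hs ht
          rw [hint t this.1.le (this.2.trans_le (min_le_left _ _)) (this.2.trans_le (min_le_right _ _))]
      _ = _ := by
          rw [← Finset.sum_mul, aux_sum_basis s (Finset.card_pos.1 (by omega)), one_mul]
  simp only [hA, MeasureTheory.integral_zero] at hfin
  have : 0 < MeasureTheory.volume.real (ball (0:E) R) :=
    ENNReal.toReal_pos (Metric.measure_ball_pos _ _ hR).ne' MeasureTheory.measure_ball_lt_top.ne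
  exact this.ne hfin

/-- Brouwer's fixed point theorem. -/
lemma aux_brouwer {E : Type*} [NormedAddCommGroup E] [InnerProductSpace ℝ E]
    [FiniteDimensional ℝ E] [MeasurableSpace E] [BorelSpace E]
    (f : E → E)
    (hf : ContinuousOn f (closedBall 0 1)) (hmap : ∀ x ∈ closedBall (0 : E) 1,
      ‖f x‖ ≤ 1) : ∃ x ∈ closedBall (0 : E) 1, f x = x := by
  by_contra! hno
  let proj : E → E := fun x => (max 1 ‖x‖)⁻¹ • x
  have hmaxpos : ∀ x : E, 0 < max 1 ‖x‖ := fun x => lt_max_of_lt_left one_pos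
  have hprojc : Continuous proj := by
    refine Continuous.smul (Continuous.inv₀ (by fun_prop) fun x => (hmaxpos x).ne') continuous_id
  have hprojm : ∀ x, proj x ∈ closedBall (0:E) 1 := by
    intro x
    rw [mem_closedBall_zero_iff, norm_smul, norm_inv, Real.norm_of_nonneg (hmaxpos x).le,
      inv_mul_le_iff₀ (hmaxpos x), mul_one]
    exact le_max_right _ _
  have hprojid : ∀ x ∈ closedBall (0:E) 1, proj x = x := by
    intro x hx
    rw [mem_closedBall_zero_iff] at hx
    simp [proj, max_eq_left hx]
  let χ : E → ℝ := fun x => max 0 (min 1 (2 - ‖x‖))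
  have hχ0 : ∀ x, 0 ≤ χ x := fun x => le_max_left _ _
  have hχ1 : ∀ x, χ x ≤ 1 := fun x => max_le zero_le_one (min_le_left _ _)
  let F : E → E := fun x => χ x • f (proj x)
  have hFc : Continuous F := by
    have h1 : Continuous fun x => f (proj x) := hf.comp_continuous hprojc hprojm
    have h2 : Continuous χ := by fun_prop
    exact h2.smul h1
  have hFn : ∀ x, ‖F x‖ ≤ 1 := by
    intro x
    rw [norm_smul, Real.norm_of_nonneg (hχ0 x)]
    exact mul_le_one₀ (hχ1 x) (norm_nonneg _) (hmap _ (hprojm x))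
  have hFne : ∀ x, 0 < ‖x - F x‖ := by
    intro x
    rw [norm_pos_iff, sub_ne_zero]
    intro hx
    have hx1 : x ∈ closedBall (0:E) 1 := by
      rw [mem_closedBall_zero_iff, hx]; exact hFn x
    have hx2 : F x = f x := by
      have : χ x = 1 := by
        rw [mem_closedBall_zero_iff] at hx1
        simp only [χ]
        rw [min_eq_left (by linarith), max_eq_right zero_le_one]
      simp [F, this, hprojid x hx1]
    exact hno x hx1 (by rw [← hx2, ← hx])
  obtain ⟨g, hg, hgF, hsupp⟩ := hFc.exists_contDiff_approx 1
    (ε := fun x => ‖x - F x‖) (by fun_prop) hFne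
  have hne : ∀ x, x - g x ≠ 0 := by
    intro x hx
    have := hgF x
    rw [← sub_eq_zero.1 hx, dist_eq_norm] at this
    exact lt_irrefl _ this
  have hgz : ∀ x, ‖x‖ = 2 → g x = 0 := by
    intro x hx
    by_contra hgx
    have : x ∈ Function.support F := hsupp hgx
    apply this
    simp [F, χ, hx]
  refine aux_no_smooth_retraction (fun x => (2 * ‖x - g x‖⁻¹) • (x - g x)) ?_ 2 two_pos ?_ ?_
  · have h1 : ContDiff ℝ 1 fun x => x - g x := contDiff_id.sub hg
    exact (contDiff_const.mul ((h1.norm ℝ hne).inv fun x => norm_ne_zero_iff.2 (hne x))).smul h1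
  · intro x
    have := norm_ne_zero_iff.2 (hne x)
    rw [norm_smul, norm_mul, norm_inv, norm_norm]
    field_simp
    norm_num
  · intro x hx
    simp only [hgz x hx, sub_zero, hx]
    norm_num

/-- Gluing a function along finitely many compact pieces. -/
lemma aux_glue {X T ι : Type*} [TopologicalSpace X] [T2Space X] [TopologicalSpace T]
    {W : ι → Type*} [∀ i, TopologicalSpace (W i)] [∀ i, T2Space (W i)] (I : Set ι)
    (hI : I.Finite) (Y : Set X) (Q : ∀ i, Set (W i)) (φ : ∀ i, W i → X) (G : X → T)
    (hQ : ∀ i ∈ I, IsCompact (Q i)) (hφ : ∀ i ∈ I, ContinuousOn (φ i) (Q i))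
    (hg : ∀ i ∈ I, ContinuousOn (fun w => G (φ i w)) (Q i))
    (hY : Y ⊆ ⋃ i ∈ I, φ i '' Q i) : ContinuousOn G Y := by
  rw [continuousOn_iff_isClosed]
  intro t ht
  refine ⟨⋃ i ∈ I, φ i '' (Q i ∩ (fun w => G (φ i w)) ⁻¹' t), ?_, ?_⟩
  · refine hI.isClosed_biUnion fun i hi => ?_
    have hc : IsClosed (Q i ∩ (fun w => G (φ i w)) ⁻¹' t) :=
      (hg i hi).preimage_isClosed_of_isClosed (hQ i hi).isClosed ht
    have hk : IsCompact (Q i ∩ (fun w => G (φ i w)) ⁻¹' t) :=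
      (hQ i hi).of_isClosed_subset hc inter_subset_left
    exact (hk.image_of_continuousOn ((hφ i hi).mono inter_subset_left)).isClosed
  · ext x
    simp only [mem_inter_iff, mem_preimage, mem_iUnion, mem_image, exists_prop]
    constructor
    · rintro ⟨hx, hxY⟩
      refine ⟨?_, hxY⟩
      have := hY hxY
      simp only [mem_iUnion, mem_image, exists_prop] at this
      obtain ⟨i, hi, w, hw, rfl⟩ := this
      exact ⟨i, hi, w, ⟨hw, hx⟩, rfl⟩
    · rintro ⟨⟨i, hi, w, ⟨hw, hx⟩, rfl⟩, hxY⟩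
      exact ⟨hx, hxY⟩

/-- A punctured sphere is an absolute extensor. -/
lemma aux_extend {M F : Type} [TopologicalSpace M] [NormalSpace M] [NormedAddCommGroup F]
    [InnerProductSpace ℝ F] [FiniteDimensional ℝ F] (A : Set M) (hA : IsClosed A) (f : M → F)
    (hf : ContinuousOn f A) (hf1 : ∀ x ∈ A, ‖f x‖ = 1) (v : F) (hv : ‖v‖ = 1)
    (hfv : ∀ x ∈ A, f x ≠ v) :
    ∃ g : M → F, Continuous g ∧ (∀ x ∈ A, g x = f x) ∧ ∀ x, ‖g x‖ = 1 ∧ g x ≠ v := by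
  let S := stereographic hv
  let f0 : A → sphere (0 : F) 1 := fun x => ⟨f x, by simpa using hf1 x x.2⟩
  have hf0 : Continuous f0 := by
    refine Continuous.subtype_mk ?_ _
    exact continuousOn_iff_continuous_domRestrict.1 hf
  have hsrc : ∀ x, f0 x ∈ S.source := by
    intro x
    simp only [S, stereographic_source, mem_compl_iff, mem_singleton_iff]
    intro h
    exact hfv x x.2 (congrArg Subtype.val h)
  let f1 : C(A, (ℝ ∙ v)ᗮ) := ⟨fun x => S (f0 x), by
    exact S.continuousOn.comp_continuous hf0 hsrc⟩
  obtain ⟨g, hg⟩ := ContinuousMap.exists_restrict_eq hA f1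
  have htgt : ∀ w, w ∈ S.target := by intro w; simp [S]
  refine ⟨fun x => (S.symm (g x) : F), ?_, ?_, ?_⟩
  · exact continuous_subtype_val.comp
      (S.continuousOn_symm.comp_continuous g.continuous fun x => htgt _)
  · intro x hx
    have h1 : g x = S (f0 ⟨x, hx⟩) := DFunLike.congr_fun hg (⟨x, hx⟩ : A)
    show (S.symm (g x) : F) = f x
    rw [h1, S.left_inv (hsrc _)]
  · intro x
    refine ⟨by simpa using (S.symm (g x)).2, fun h => ?_⟩
    have := S.map_target (htgt (g x))
    simp only [S, stereographic_source, mem_compl_iff, mem_singleton_iff] at this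
    exact this (Subtype.ext h)

/-- The collapse of the boundary of a ball. -/
lemma aux_collapse (V : Type) [NormedAddCommGroup V] [InnerProductSpace ℝ V] :
    ∃ (b : V → WithLp 2 (V × ℝ)) (s : WithLp 2 (V × ℝ)), Continuous b ∧ ‖s‖ = 1 ∧
      (∀ y, ‖y‖ ≤ 1 → ‖b y‖ = 1) ∧ (∀ y, ‖y‖ = 1 → b y = s) ∧ (∀ y, ‖y‖ < 1 → b y ≠ s) ∧
      (∀ y z, ‖y‖ < 1 → ‖z‖ < 1 → b y = b z → y = z) ∧
      (∀ t, ‖t‖ = 1 → t ≠ s → ∃ y, ‖y‖ < 1 ∧ b y = t) := by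
  refine ⟨fun y => WithLp.toLp 2 ((2 * Real.sqrt (1 - ‖y‖ ^ 2)) • y, 2 * ‖y‖ ^ 2 - 1),
    WithLp.toLp 2 (0, 1), ?_, ?_, ?_, ?_, ?_, ?_, ?_⟩
  · fun_prop
  · rw [← sq_eq_sq₀ (norm_nonneg _) zero_le_one, WithLp.prod_norm_sq_eq_of_L2]
    simp
  · intro y hy
    rw [← sq_eq_sq₀ (norm_nonneg _) zero_le_one, WithLp.prod_norm_sq_eq_of_L2]
    have h : 0 ≤ 1 - ‖y‖ ^ 2 := by nlinarith [norm_nonneg y]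
    show ‖(2 * Real.sqrt (1 - ‖y‖ ^ 2)) • y‖ ^ 2 + ‖2 * ‖y‖ ^ 2 - 1‖ ^ 2 = 1 ^ 2
    simp only [norm_smul, mul_pow, norm_mul, Real.norm_eq_abs, sq_abs, Real.sq_sqrt h]
    ring
  · intro y hy
    simp [hy]
    norm_num
  · intro y hy h
    have h2 := congrArg (fun t : WithLp 2 (V × ℝ) => t.snd) h
    simp at h2
    nlinarith [norm_nonneg y]
  · intro y z hy hz h
    have h2 := congrArg (fun t : WithLp 2 (V × ℝ) => t.snd) h
    have h1 := congrArg (fun t : WithLp 2 (V × ℝ) => t.fst) h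
    change 2 * ‖y‖ ^ 2 - 1 = 2 * ‖z‖ ^ 2 - 1 at h2
    change (2 * Real.sqrt (1 - ‖y‖ ^ 2)) • y = (2 * Real.sqrt (1 - ‖z‖ ^ 2)) • z at h1
    have h3 : ‖y‖ ^ 2 = ‖z‖ ^ 2 := by linarith
    rw [h3] at h1
    have h4 : 0 < 2 * Real.sqrt (1 - ‖z‖ ^ 2) := by
      have : 0 < 1 - ‖z‖ ^ 2 := by nlinarith [norm_nonneg z]
      positivity
    exact smul_right_injective V h4.ne' h1
  · intro t ht hts
    have h1 : ‖t.fst‖ ^ 2 + t.snd ^ 2 = 1 := by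
      have := WithLp.prod_norm_sq_eq_of_L2 t
      rw [ht] at this
      simpa using this.symm
    have h2 : t.snd < 1 := by
      by_contra hh
      have h3 : t.snd = 1 := by nlinarith [sq_nonneg ‖t.fst‖]
      rw [h3] at h1
      have h4 : t.fst = 0 := by
        have : ‖t.fst‖ ^ 2 = 0 := by linarith
        simpa using this
      apply hts
      rw [← WithLp.toLp_ofLp 2 t]
      congr 1
      exact Prod.ext h4 h3
    have hq : 0 < (1 - t.snd) / 2 := by linarith
    set q := Real.sqrt ((1 - t.snd) / 2) with hqdef
    have hqpos : 0 < q := Real.sqrt_pos.2 hq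
    have hqsq : q ^ 2 = (1 - t.snd) / 2 := Real.sq_sqrt hq.le
    have hn : ‖(2 * q)⁻¹ • t.fst‖ ^ 2 = (1 + t.snd) / 2 := by
      rw [norm_smul, mul_pow, norm_inv, Real.norm_of_nonneg (by positivity), inv_pow, mul_pow, hqsq]
      have h5 : ‖t.fst‖ ^ 2 = (1 - t.snd) * (1 + t.snd) := by linarith
      rw [h5]
      have : 1 - t.snd ≠ 0 := by linarith
      field_simp
    refine ⟨(2 * q)⁻¹ • t.fst, ?_, ?_⟩
    · rw [← sq_lt_sq₀ (norm_nonneg _) zero_le_one, hn]; linarith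
    · have h6 : Real.sqrt (1 - ‖(2 * q)⁻¹ • t.fst‖ ^ 2) = q := by
        rw [hn, hqdef]; congr 1; ring
      simp only [h6]
      rw [hn, smul_smul, mul_inv_cancel₀ (by positivity), one_smul]
      rw [← WithLp.toLp_ofLp 2 t]
      congr 1
      refine Prod.ext rfl ?_
      show 2 * ((1 + t.snd) / 2) - 1 = t.snd
      ring

/-- Retraction of a punctured ball onto the sphere. -/
lemma aux_puncture {E : Type*} [NormedAddCommGroup E] [NormedSpace ℝ E] (z : E) (hz : ‖z‖ < 1) :
    ∃ k : E → E, ContinuousOn k (closedBall 0 1 \ {z}) ∧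
      (∀ y ∈ closedBall (0 : E) 1 \ {z}, ‖k y‖ = 1) ∧ (∀ y, ‖y‖ = 1 → k y = y) ∧
      (z = 0 → ∀ y, ‖y‖ = 1 → k ((1 / 2 : ℝ) • y) = y) := by
  let a : E → E := fun y => y - ((1 - ‖y‖) / (1 - ‖z‖)) • z
  have ha : Continuous a := by fun_prop
  have hz' : 0 < 1 - ‖z‖ := by linarith
  have hne : ∀ y ∈ closedBall (0 : E) 1 \ {z}, ‖a y‖ ≠ 0 := by
    rintro y ⟨hy, hyz⟩ h
    rw [mem_closedBall_zero_iff] at hy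
    have h1 : y = ((1 - ‖y‖) / (1 - ‖z‖)) • z := sub_eq_zero.1 (norm_eq_zero.1 h)
    have h2 : ‖y‖ = ((1 - ‖y‖) / (1 - ‖z‖)) * ‖z‖ := by
      conv_lhs => rw [h1]
      rw [norm_smul, Real.norm_of_nonneg (div_nonneg (by linarith) hz'.le)]
    have h3 : ‖y‖ = ‖z‖ := by
      field_simp at h2
      linarith
    rw [h3, div_self hz'.ne', one_smul] at h1
    exact hyz h1
  refine ⟨fun y => ‖a y‖⁻¹ • a y, ?_, ?_, ?_, ?_⟩
  · exact (ha.norm.continuousOn.inv₀ hne).smul ha.continuousOn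
  · intro y hy
    rw [norm_smul, norm_inv, norm_norm, inv_mul_cancel₀ (hne y hy)]
  · intro y hy
    simp [a, hy]
  · intro h y hy
    simp [a, hy, h, norm_smul, smul_smul]

/-- The pinch map. -/
noncomputable def auxPinch {E : Type*} [NormedAddCommGroup E] [NormedSpace ℝ E] (x : E) (ε : ℝ)
    (y : E) : E := max 0 (ε - ‖y - x‖) • y - min ‖y - x‖ ε • x

lemma aux_pinch_continuous {E : Type*} [NormedAddCommGroup E] [NormedSpace ℝ E] (x : E) (ε : ℝ) :
    Continuous (auxPinch x ε) := by
  unfold auxPinch; fun_prop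

lemma aux_pinch_far {E : Type*} [NormedAddCommGroup E] [NormedSpace ℝ E] (x : E) (ε : ℝ) (y : E)
    (h : ε ≤ ‖y - x‖) : auxPinch x ε y = - ε • x := by
  unfold auxPinch
  rw [max_eq_left (by linarith), min_eq_right h]; simp

lemma aux_pinch_ne {E : Type*} [NormedAddCommGroup E] [NormedSpace ℝ E] (x : E) (ε : ℝ)
    (hε : 0 < ε) (hx : ‖x‖ = 1) (y : E) (hy : ‖y‖ = 1) (c : ℝ) (hc : 0 ≤ c) :
    auxPinch x ε y ≠ - c • y := by
  intro h
  have h1 : (max 0 (ε - ‖y - x‖) + c) • y = min ‖y - x‖ ε • x := by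
    unfold auxPinch at h
    rw [← sub_eq_zero] at h ⊢
    rw [← h]; module
  have hm : 0 ≤ min ‖y - x‖ ε := le_min (norm_nonneg _) hε.le
  have h2 : max 0 (ε - ‖y - x‖) + c = min ‖y - x‖ ε := by
    have := congrArg norm h1
    rwa [norm_smul, norm_smul, hx, hy, mul_one, mul_one, Real.norm_of_nonneg hm,
      Real.norm_of_nonneg (add_nonneg (le_max_left _ _) hc)] at this
  rw [h2] at h1
  rcases hm.eq_or_lt with h0 | h0
  · have h3 := le_max_left 0 (ε - ‖y - x‖)
    have h4 := le_max_right 0 (ε - ‖y - x‖)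
    rw [← h0] at h2
    rcases le_total ‖y - x‖ ε with h5 | h5
    · rw [min_eq_left h5] at h0
      linarith
    · rw [min_eq_right h5] at h0
      linarith
  · have : y = x := smul_right_injective E h0.ne' h1
    rw [this] at h0
    simp at h0

/-- Consequence of Brouwer's theorem: a map of the ball which never points opposite to the
outward normal on the sphere has a zero. -/
lemma aux_zero {E : Type*} [NormedAddCommGroup E] [InnerProductSpace ℝ E]
    [FiniteDimensional ℝ E] [MeasurableSpace E] [BorelSpace E] (h : E → E)
    (hh : ContinuousOn h (closedBall 0 1)) (h0 : ∀ y ∈ closedBall (0 : E) 1, h y ≠ 0)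
    (hs : ∀ y, ‖y‖ = 1 → ∀ c : ℝ, 0 ≤ c → h y ≠ - c • y) : False := by
  have hn : ∀ y ∈ closedBall (0 : E) 1, ‖h y‖ ≠ 0 := fun y hy => norm_ne_zero_iff.2 (h0 y hy)
  obtain ⟨y, hy, hfix⟩ := aux_brouwer (fun y => - (‖h y‖⁻¹ • h y))
    ((hh.norm.inv₀ hn).smul hh).neg (by
      intro y hy
      rw [norm_neg, norm_smul, norm_inv, norm_norm, inv_mul_cancel₀ (hn y hy)])
  have hy1 : ‖y‖ = 1 := by
    rw [← hfix, norm_neg, norm_smul, norm_inv, norm_norm, inv_mul_cancel₀ (hn y hy)]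
  refine hs y hy1 ‖h y‖ (norm_nonneg _) ?_
  have h5 : - ‖h y‖ • (- (‖h y‖⁻¹ • h y)) = h y := by
    rw [smul_neg, neg_smul, neg_neg, smul_smul, mul_inv_cancel₀ (hn y hy), one_smul]
  have hfix2 : - (‖h y‖⁻¹ • h y) = y := hfix
  rw [hfix2] at h5
  exact h5.symm

namespace CWComplexCells

lemma aux_cell_eq {X : Type} [TopologicalSpace X] [T2Space X] (K : CWComplexCells X)
    {ρ ρ' : K.Cell} {y : EuclideanSpace ℝ (Fin (K.dim ρ))} {y' : EuclideanSpace ℝ (Fin (K.dim ρ'))}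
    (hy : ‖y‖ < 1) (hy' : ‖y'‖ < 1) (h : K.charMap ρ y = K.charMap ρ' y') : ρ = ρ' := by
  by_contra hne
  exact Set.disjoint_left.1 (K.cells_disjoint ρ ρ' hne) ⟨y, by simpa using hy, rfl⟩
    ⟨y', by simpa using hy', h.symm⟩

lemma aux_sigma_eq {X : Type} [TopologicalSpace X] [T2Space X] (K : CWComplexCells X)
    {ρ ρ' : K.Cell} {y : EuclideanSpace ℝ (Fin (K.dim ρ))} {y' : EuclideanSpace ℝ (Fin (K.dim ρ'))}
    (hy : ‖y‖ < 1) (hy' : ‖y'‖ < 1) (h : K.charMap ρ y = K.charMap ρ' y') :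
    (⟨ρ, y⟩ : Σ r : K.Cell, EuclideanSpace ℝ (Fin (K.dim r))) = ⟨ρ', y'⟩ := by
  obtain rfl := K.aux_cell_eq hy hy' h
  rw [K.charMap_injOn ρ (by simpa using hy) (by simpa using hy') h]

lemma aux_sphere_lt {X : Type} [TopologicalSpace X] [T2Space X] (K : CWComplexCells X)
    {ρ ρ' : K.Cell} {y : EuclideanSpace ℝ (Fin (K.dim ρ))} {y' : EuclideanSpace ℝ (Fin (K.dim ρ'))}
    (hy : ‖y‖ = 1) (hy' : ‖y'‖ < 1) (h : K.charMap ρ y = K.charMap ρ' y') :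
    K.dim ρ' < K.dim ρ := by
  obtain ⟨I, -, hI, hs⟩ := K.sphere_subset ρ
  have h1 := hs ⟨y, by simpa using hy, rfl⟩
  simp only [mem_iUnion, exists_prop] at h1
  obtain ⟨r, hr, w, hw, hwe⟩ := h1
  have h2 : r = ρ' := K.aux_cell_eq (by simpa using hw) hy' (hwe.trans h)
  rw [← h2]
  exact hI r hr

lemma aux_cell_of {X : Type} [TopologicalSpace X] [T2Space X] (K : CWComplexCells X) (x : X) :
    ∃ (ρ : K.Cell) (y : EuclideanSpace ℝ (Fin (K.dim ρ))), ‖y‖ < 1 ∧ K.charMap ρ y = x := by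
  have h : x ∈ ⋃ τ : K.Cell, K.charMap τ '' ball 0 1 := by rw [K.cells_cover]; trivial
  simp only [mem_iUnion] at h
  obtain ⟨ρ, y, hy, hx⟩ := h
  exact ⟨ρ, y, by simpa using hy, hx⟩

lemma aux_dim_le {X : Type} [TopologicalSpace X] [T2Space X] (K : CWComplexCells X)
    {ρ ρ' : K.Cell} {y : EuclideanSpace ℝ (Fin (K.dim ρ))} {y' : EuclideanSpace ℝ (Fin (K.dim ρ'))}
    (hy : ‖y‖ ≤ 1) (hy' : ‖y'‖ < 1) (h : K.charMap ρ y = K.charMap ρ' y') :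
    ρ = ρ' ∨ K.dim ρ' < K.dim ρ := by
  rcases hy.lt_or_eq with h1 | h1
  · exact Or.inl (K.aux_cell_eq h1 hy' h)
  · exact Or.inr (K.aux_sphere_lt h1 hy' h)

/-- Collapse of the complement of the cell `ν` to a point. -/
lemma aux_kappa {X : Type} [TopologicalSpace X] [T2Space X] (K : CWComplexCells X) (ν : K.Cell) :
    ∃ (κ : X → WithLp 2 (EuclideanSpace ℝ (Fin (K.dim ν)) × ℝ))
      (s : WithLp 2 (EuclideanSpace ℝ (Fin (K.dim ν)) × ℝ)),
      ‖s‖ = 1 ∧ (∀ x, ‖κ x‖ = 1) ∧ (∀ x ∉ K.cellSet ν, κ x = s) ∧ (∀ x ∈ K.cellSet ν, κ x ≠ s) ∧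
      InjOn κ (K.cellSet ν) ∧ (∀ t, ‖t‖ = 1 → t ≠ s → ∃ x ∈ K.cellSet ν, κ x = t) ∧
      ∀ (Y : Set X) (I : Set K.Cell), I.Finite → (∀ ρ ∈ I, K.dim ρ ≤ K.dim ν) →
        Y ⊆ ⋃ ρ ∈ I, K.charMap ρ '' closedBall 0 1 → ContinuousOn κ Y := by
  classical
  obtain ⟨b, s, hb, hs, hb1, hbs, hbne, hbinj, hbsurj⟩ :=
    aux_collapse (EuclideanSpace ℝ (Fin (K.dim ν)))
  let κ : X → WithLp 2 (EuclideanSpace ℝ (Fin (K.dim ν)) × ℝ) := fun x =>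
    if h : ∃ y : EuclideanSpace ℝ (Fin (K.dim ν)), ‖y‖ < 1 ∧ K.charMap ν y = x
    then b h.choose else s
  have k1 : ∀ y, ‖y‖ < 1 → κ (K.charMap ν y) = b y := by
    intro y hy
    have h : ∃ y' : EuclideanSpace ℝ (Fin (K.dim ν)), ‖y'‖ < 1 ∧ K.charMap ν y' = K.charMap ν y :=
      ⟨y, hy, rfl⟩
    have h2 : κ (K.charMap ν y) = b h.choose := dif_pos h
    rw [h2, K.charMap_injOn ν (by simpa using h.choose_spec.1) (by simpa using hy) h.choose_spec.2]
  have k2 : ∀ x ∉ K.cellSet ν, κ x = s := by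
    intro x hx
    refine dif_neg ?_
    rintro ⟨y, hy, rfl⟩
    exact hx ⟨y, by simpa using hy, rfl⟩
  refine ⟨κ, s, hs, ?_, k2, ?_, ?_, ?_, ?_⟩
  · intro x
    by_cases hx : x ∈ K.cellSet ν
    · obtain ⟨y, hy, rfl⟩ := hx
      have hy' : ‖y‖ < 1 := by simpa using hy
      rw [k1 y hy', hb1 y hy'.le]
    · rw [k2 x hx, hs]
  · rintro _ ⟨y, hy, rfl⟩
    have hy' : ‖y‖ < 1 := by simpa using hy
    rw [k1 y hy']
    exact hbne y hy'
  · rintro _ ⟨y, hy, rfl⟩ _ ⟨z, hz, rfl⟩ h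
    have hy' : ‖y‖ < 1 := by simpa using hy
    have hz' : ‖z‖ < 1 := by simpa using hz
    rw [k1 y hy', k1 z hz'] at h
    rw [hbinj y z hy' hz' h]
  · intro t ht hts
    obtain ⟨y, hy, rfl⟩ := hbsurj t ht hts
    exact ⟨_, ⟨y, by simpa using hy, rfl⟩, k1 y hy⟩
  · intro Y I hI hdim hY
    refine aux_glue I hI Y (fun _ => closedBall 0 1) K.charMap κ
      (fun i _ => isCompact_closedBall _ _) (fun i _ => K.charMap_continuousOn i) ?_ hY
    intro ρ hρ
    by_cases h : ρ = ν
    · subst h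
      refine hb.continuousOn.congr ?_
      intro y hy
      rcases (mem_closedBall_zero_iff.1 hy).lt_or_eq with h1 | h1
      · exact k1 y h1
      · show κ _ = b y
        rw [hbs y h1]
        refine k2 _ ?_
        rintro ⟨z, hz, hzy⟩
        exact lt_irrefl _ (K.aux_sphere_lt h1 (by simpa using hz) hzy.symm)
    · refine (continuousOn_const (c := s)).congr ?_
      intro y hy
      refine k2 _ ?_
      rintro ⟨z, hz, hzy⟩
      rcases K.aux_dim_le (mem_closedBall_zero_iff.1 hy) (by simpa using hz) hzy.symm with h1 | h1
      · exact h h1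
      · exact absurd (hdim ρ hρ) (by omega)

lemma aux_kappa_sphere {X F : Type} [TopologicalSpace X] [T2Space X] [TopologicalSpace F]
    (K : CWComplexCells X) (ν ρ : K.Cell) (κ : X → F)
    (hκ : ∀ (Y : Set X) (I : Set K.Cell), I.Finite → (∀ ρ ∈ I, K.dim ρ ≤ K.dim ν) →
        Y ⊆ ⋃ ρ ∈ I, K.charMap ρ '' closedBall 0 1 → ContinuousOn κ Y)
    (hρ : K.dim ρ = K.dim ν + 1) :
    ContinuousOn (fun y => κ (K.charMap ρ y)) (sphere 0 1) := by
  obtain ⟨I, hI, hId, hs⟩ := K.sphere_subset ρ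
  have h1 : ContinuousOn κ (K.charMap ρ '' sphere 0 1) := by
    refine hκ _ I hI (fun r hr => by have := hId r hr; omega) (hs.trans ?_)
    exact iUnion₂_mono fun r _ => image_mono ball_subset_closedBall
  exact h1.comp ((K.charMap_continuousOn ρ).mono sphere_subset_closedBall) (mapsTo_image _ _)

/-- The map from the collapsed complex to the ambient space of the disk of `σ`. -/
lemma aux_q {X F : Type} [TopologicalSpace X] [T2Space X] [NormedAddCommGroup F]
    (K : CWComplexCells X) (ν σ : K.Cell) (h₁ : K.RegularFacet ν σ) (κ : X → F) (s : F)
    (hκ1 : ∀ x, ‖κ x‖ = 1)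
    (hκs : ∀ x ∉ K.cellSet ν, κ x = s) (hκne : ∀ x ∈ K.cellSet ν, κ x ≠ s)
    (hκinj : InjOn κ (K.cellSet ν))
    (hκsurj : ∀ t, ‖t‖ = 1 → t ≠ s → ∃ x ∈ K.cellSet ν, κ x = t)
    (hκ : ∀ (Y : Set X) (I : Set K.Cell), I.Finite → (∀ ρ ∈ I, K.dim ρ ≤ K.dim ν) →
        Y ⊆ ⋃ ρ ∈ I, K.charMap ρ '' closedBall 0 1 → ContinuousOn κ Y) :
    ∃ q : F → EuclideanSpace ℝ (Fin (K.dim σ)), ContinuousOn q (sphere 0 1) ∧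
      (∀ t, q t ≠ 0) ∧
      ∀ y, ‖y‖ = 1 → ∀ c : ℝ, 0 ≤ c → q (κ (K.charMap σ y)) ≠ - c • y := by
  classical
  obtain ⟨⟨hface, ⟨e, he⟩, -⟩, hdim⟩ := h₁
  have hinj : ∀ y y' : EuclideanSpace ℝ (Fin (K.dim σ)), ‖y‖ = 1 → ‖y'‖ = 1 →
      K.charMap σ y ∈ K.cellSet ν → K.charMap σ y = K.charMap σ y' → y = y' := by
    intro y y' hy hy' h h'
    have m : y ∈ K.preim ν σ := ⟨by simp [hy], h⟩
    have m' : y' ∈ K.preim ν σ := ⟨by simp [hy'], by rw [mem_preimage, ← h']; exact h⟩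
    have : e ⟨y, m⟩ = e ⟨y', m'⟩ := Subtype.ext (by rw [he, he]; exact h')
    exact congrArg Subtype.val (e.injective this)
  have honS : ∀ x ∈ K.cellSet ν, ∃ y : EuclideanSpace ℝ (Fin (K.dim σ)), ‖y‖ = 1 ∧
      K.charMap σ y = x := by
    intro x hx
    obtain ⟨h1, h2⟩ := hface hx
    unfold cellSet at h1
    rw [K.closure_cell] at h1
    obtain ⟨y, hy, rfl⟩ := h1
    refine ⟨y, ?_, rfl⟩
    rcases (mem_closedBall_zero_iff.1 hy).lt_or_eq with h3 | h3
    · exact absurd ⟨y, by simpa using h3, rfl⟩ h2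
    · exact h3
  obtain ⟨x, hx, hxν⟩ := honS (K.charMap ν 0) ⟨0, by simp, rfl⟩
  obtain ⟨ε, hε, hfar⟩ : ∃ ε : ℝ, 0 < ε ∧ ∀ y : EuclideanSpace ℝ (Fin (K.dim σ)), ‖y‖ = 1 →
      K.charMap σ y ∉ K.cellSet ν → ε ≤ ‖y - x‖ := by
    obtain ⟨I, hI, hId, hs⟩ := K.sphere_subset σ
    let Z : Set X := ⋃ ρ ∈ I \ {ν}, K.charMap ρ '' closedBall 0 1
    have hZ : IsClosed Z := by
      refine (hI.subset sdiff_subset).isClosed_biUnion fun ρ _ => ?_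
      exact ((isCompact_closedBall _ _).image_of_continuousOn (K.charMap_continuousOn ρ)).isClosed
    have hC : IsClosed (sphere (0 : EuclideanSpace ℝ (Fin (K.dim σ))) 1 ∩ K.charMap σ ⁻¹' Z) :=
      ((K.charMap_continuousOn σ).mono sphere_subset_closedBall).preimage_isClosed_of_isClosed
        isClosed_sphere hZ
    have hxC : x ∈ (sphere (0 : EuclideanSpace ℝ (Fin (K.dim σ))) 1 ∩ K.charMap σ ⁻¹' Z)ᶜ := by
      rintro ⟨-, hxZ⟩
      simp only [Z, mem_preimage, mem_iUnion, exists_prop] at hxZ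
      obtain ⟨ρ, ⟨hρ, hρν⟩, w, hw, hwe⟩ := hxZ
      rcases K.aux_dim_le (ρ' := ν) (y' := 0) (mem_closedBall_zero_iff.1 hw) (by simp)
        (hwe.trans hxν) with h | h
      · exact hρν h
      · have := hId ρ hρ
        omega
    obtain ⟨ε, hε, hb⟩ := Metric.isOpen_iff.1 hC.isOpen_compl x hxC
    refine ⟨ε, hε, fun y hy hyν => ?_⟩
    by_contra hlt
    have h1 : y ∈ ball x ε := by rw [mem_ball, dist_eq_norm]; linarith
    refine hb h1 ⟨by simpa using hy, ?_⟩
    have h2 := hs ⟨y, by simpa using hy, rfl⟩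
    simp only [mem_iUnion, exists_prop] at h2
    obtain ⟨ρ, hρ, hyρ⟩ := h2
    simp only [Z, mem_preimage, mem_iUnion, exists_prop]
    refine ⟨ρ, ⟨hρ, ?_⟩, image_mono ball_subset_closedBall hyρ⟩
    rintro rfl
    exact hyν hyρ
  let q : F → EuclideanSpace ℝ (Fin (K.dim σ)) := fun t =>
    if h : ∃ y : EuclideanSpace ℝ (Fin (K.dim σ)), ‖y‖ = 1 ∧ κ (K.charMap σ y) = t
    then auxPinch x ε h.choose else - ε • x
  have key : ∀ y y' : EuclideanSpace ℝ (Fin (K.dim σ)), ‖y‖ = 1 → ‖y'‖ = 1 →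
      κ (K.charMap σ y) = κ (K.charMap σ y') → auxPinch x ε y = auxPinch x ε y' := by
    intro y y' hy hy' h
    by_cases hyν : K.charMap σ y ∈ K.cellSet ν
    · have hyν' : K.charMap σ y' ∈ K.cellSet ν := by
        by_contra hh
        exact hκne _ hyν (h.trans (hκs _ hh))
      rw [hinj y y' hy hy' hyν (hκinj hyν hyν' h)]
    · have hyν' : K.charMap σ y' ∉ K.cellSet ν := by
        intro hh
        exact hκne _ hh (h.symm.trans (hκs _ hyν))
      rw [aux_pinch_far x ε y (hfar y hy hyν), aux_pinch_far x ε y' (hfar y' hy' hyν')]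
  have hq : ∀ y : EuclideanSpace ℝ (Fin (K.dim σ)), ‖y‖ = 1 →
      q (κ (K.charMap σ y)) = auxPinch x ε y := by
    intro y hy
    have h : ∃ y' : EuclideanSpace ℝ (Fin (K.dim σ)), ‖y'‖ = 1 ∧
      κ (K.charMap σ y') = κ (K.charMap σ y) := ⟨y, hy, rfl⟩
    have h2 : q (κ (K.charMap σ y)) = auxPinch x ε h.choose := dif_pos h
    rw [h2]
    exact key _ _ h.choose_spec.1 hy h.choose_spec.2
  refine ⟨q, ?_, ?_, ?_⟩
  · refine aux_glue (ι := Bool) (W := fun _ => EuclideanSpace ℝ (Fin (K.dim σ))) univ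
      finite_univ _ (fun i => if i then sphere 0 1 else {0})
      (fun i => if i then fun y => κ (K.charMap σ y) else fun _ => s) q ?_ ?_ ?_ ?_
    · rintro (_ | _) -
      · simp
      · simpa using isCompact_sphere _ _
    · rintro (_ | _) -
      · simp
      · simpa using K.aux_kappa_sphere ν σ κ hκ hdim.symm
    · rintro (_ | _) -
      · simp
      · simp only [if_true]
        exact (aux_pinch_continuous x ε).continuousOn.congr fun y hy => hq y (by simpa using hy)
    · intro t ht
      have ht1 : ‖t‖ = 1 := by simpa using ht
      simp only [mem_univ, iUnion_true, mem_iUnion]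
      by_cases hts : t = s
      · exact ⟨false, 0, by simp, by simp [hts]⟩
      · obtain ⟨p, hp, hpt⟩ := hκsurj t ht1 hts
        obtain ⟨y, hy, hyp⟩ := honS p hp
        exact ⟨true, y, by simpa using hy, by simp [hyp, hpt]⟩
  · intro t
    by_cases h : ∃ y : EuclideanSpace ℝ (Fin (K.dim σ)), ‖y‖ = 1 ∧ κ (K.charMap σ y) = t
    · obtain ⟨y, hy, rfl⟩ := h
      rw [hq y hy]
      simpa using aux_pinch_ne x ε hε hx y hy 0 le_rfl
    · have h2 : q t = - ε • x := dif_neg h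
      rw [h2]
      have hx0 : x ≠ 0 := by
        rintro rfl
        simp at hx
      exact smul_ne_zero (by simpa using hε.ne') hx0
  · intro y hy c hc
    rw [hq y hy]
    exact aux_pinch_ne x ε hε hx y hy c hc

/-- A disk in the boundary of `τ` bounded by the sphere in `σ`, missing the center of `σ`. -/
lemma aux_j {X : Type} [TopologicalSpace X] [T2Space X]
    (K : CWComplexCells X) (σ τ : K.Cell) (h₂ : K.RegularFacet σ τ) :
    ∃ j : EuclideanSpace ℝ (Fin (K.dim σ)) → EuclideanSpace ℝ (Fin (K.dim τ)), Continuous j ∧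
      (∀ y, ‖j y‖ = 1) ∧ (∀ y, K.charMap τ (j y) ≠ K.charMap σ 0) ∧
      ∀ y, ‖y‖ = 1 → K.charMap τ (j y) = K.charMap σ ((1 / 2 : ℝ) • y) := by
  classical
  obtain ⟨⟨hface, ⟨e, he⟩, -⟩, -⟩ := h₂
  let inv : X → EuclideanSpace ℝ (Fin (K.dim τ)) := fun x =>
    if h : x ∈ K.cellSet σ then (e.symm ⟨x, h⟩ : EuclideanSpace ℝ (Fin (K.dim τ))) else 0
  have hinv : ∀ x (h : x ∈ K.cellSet σ),
      inv x = (e.symm ⟨x, h⟩ : EuclideanSpace ℝ (Fin (K.dim τ))) := fun x h => dif_pos h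
  have hc : ContinuousOn inv (K.cellSet σ) := by
    rw [continuousOn_iff_continuous_domRestrict]
    have : Continuous fun x : K.cellSet σ => (e.symm x : EuclideanSpace ℝ (Fin (K.dim τ))) :=
      continuous_subtype_val.comp e.symm.continuous
    refine this.congr ?_
    rintro ⟨x, h⟩
    exact (hinv x h).symm
  have hmem : ∀ x ∈ K.cellSet σ, inv x ∈ K.preim σ τ := by
    intro x h
    rw [hinv x h]
    exact (e.symm ⟨x, h⟩).2
  have hφ : ∀ x ∈ K.cellSet σ, K.charMap τ (inv x) = x := by
    intro x h
    rw [hinv x h, ← he, e.apply_symm_apply]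
  have hinj : ∀ w ∈ K.preim σ τ, ∀ w' ∈ K.preim σ τ, K.charMap τ w = K.charMap τ w' → w = w' := by
    intro w m w' m' h
    have : e ⟨w, m⟩ = e ⟨w', m'⟩ := Subtype.ext (by rw [he, he]; exact h)
    exact congrArg Subtype.val (e.injective this)
  have hn : ∀ x ∈ K.cellSet σ, ‖inv x‖ = 1 := by
    intro x h
    rcases (mem_closedBall_zero_iff.1 (hmem x h).1).lt_or_eq with h3 | h3
    · exact absurd ⟨inv x, by simpa using h3, hφ x h⟩ (hface h).2
    · exact h3
  have hhalf : ∀ y : EuclideanSpace ℝ (Fin (K.dim σ)), ‖y‖ = 1 →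
      (1 / 2 : ℝ) • y ∈ ball (0 : EuclideanSpace ℝ (Fin (K.dim σ))) 1 := by
    intro y hy
    rw [mem_ball_zero_iff, norm_smul, hy]
    norm_num
  have h0 : K.charMap σ 0 ∈ K.cellSet σ := ⟨0, by simp, rfl⟩
  have hh : ∀ y : EuclideanSpace ℝ (Fin (K.dim σ)), ‖y‖ = 1 →
      K.charMap σ ((1 / 2 : ℝ) • y) ∈ K.cellSet σ := fun y hy => ⟨_, hhalf y hy, rfl⟩
  obtain ⟨g, hg, hgA, hg1⟩ := aux_extend (sphere (0 : EuclideanSpace ℝ (Fin (K.dim σ))) 1)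
    isClosed_sphere (fun y => inv (K.charMap σ ((1 / 2 : ℝ) • y)))
    (by
      refine hc.comp ((K.charMap_continuousOn σ).comp (by fun_prop) ?_) ?_
      · intro y hy
        exact ball_subset_closedBall (hhalf y (by simpa using hy))
      · intro y hy
        exact hh y (by simpa using hy))
    (fun y hy => hn _ (hh y (by simpa using hy))) (inv (K.charMap σ 0)) (hn _ h0)
    (by
      intro y hy h
      have hy1 : ‖y‖ = 1 := by simpa using hy
      have h3 := congrArg (K.charMap τ) h
      rw [hφ _ (hh y hy1), hφ _ h0] at h3
      have h4 := K.charMap_injOn σ (hhalf y hy1) (by simp) h3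
      have h5 : y = 0 := by simpa using h4
      rw [h5] at hy1
      simp at hy1)
  refine ⟨g, hg, fun y => (hg1 y).1, ?_, ?_⟩
  · intro y h
    refine (hg1 y).2 (hinj _ ⟨by simp [(hg1 y).1], ?_⟩ _ (hmem _ h0) ?_)
    · rw [mem_preimage, h]; exact h0
    · rw [h, hφ _ h0]
  · intro y hy
    rw [hgA y (by simpa using hy)]
    exact hφ _ (hh y hy)

/-- Extension over a cell whose closure does not contain `ν`. -/
lemma aux_gA {X F : Type} [TopologicalSpace X] [T2Space X] [NormedAddCommGroup F]
    [InnerProductSpace ℝ F] [FiniteDimensional ℝ F]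
    (K : CWComplexCells X) (ν ρ : K.Cell) (κ : X → F) (s : F) (hκ1 : ∀ x, ‖κ x‖ = 1)
    (hκs : ∀ x ∉ K.cellSet ν, κ x = s) (hκne : ∀ x ∈ K.cellSet ν, κ x ≠ s)
    (hκinj : InjOn κ (K.cellSet ν))
    (hκ : ∀ (Y : Set X) (I : Set K.Cell), I.Finite → (∀ ρ ∈ I, K.dim ρ ≤ K.dim ν) →
        Y ⊆ ⋃ ρ ∈ I, K.charMap ρ '' closedBall 0 1 → ContinuousOn κ Y)
    (hρ : K.dim ρ = K.dim ν + 1) (p : X) (hp : p ∈ K.cellSet ν)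
    (hpρ : p ∉ K.charMap ρ '' closedBall 0 1) :
    ∃ g : EuclideanSpace ℝ (Fin (K.dim ρ)) → F, Continuous g ∧
      (∀ y, ‖y‖ = 1 → g y = κ (K.charMap ρ y)) ∧ ∀ y, ‖g y‖ = 1 := by
  obtain ⟨g, hg, hgA, hg1⟩ := aux_extend (sphere (0 : EuclideanSpace ℝ (Fin (K.dim ρ))) 1)
    isClosed_sphere (fun y => κ (K.charMap ρ y)) (K.aux_kappa_sphere ν ρ κ hκ hρ)
    (fun y _ => hκ1 _) (κ p) (hκ1 p)
    (by
      intro y hy h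
      have hyν : K.charMap ρ y ∈ K.cellSet ν := by
        by_contra hh
        exact hκne p hp (h.symm.trans (hκs _ hh))
      exact hpρ ⟨y, sphere_subset_closedBall hy, hκinj hyν hp h⟩)
  exact ⟨g, hg, fun y hy => hgA y (by simpa using hy), fun y => (hg1 y).1⟩

/-- Extension over a cell not contained in `Y`. -/
lemma aux_gB {X F : Type} [TopologicalSpace X] [T2Space X] [NormedAddCommGroup F]
    (K : CWComplexCells X) (ν ρ : K.Cell) (κ : X → F) (hκ1 : ∀ x, ‖κ x‖ = 1)
    (hκ : ∀ (Y : Set X) (I : Set K.Cell), I.Finite → (∀ ρ ∈ I, K.dim ρ ≤ K.dim ν) →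
        Y ⊆ ⋃ ρ ∈ I, K.charMap ρ '' closedBall 0 1 → ContinuousOn κ Y)
    (hρ : K.dim ρ = K.dim ν + 1) (Y : Set X) (z : EuclideanSpace ℝ (Fin (K.dim ρ)))
    (hz : ‖z‖ < 1) (hzY : K.charMap ρ z ∉ Y) :
    ∃ g : EuclideanSpace ℝ (Fin (K.dim ρ)) → F,
      ContinuousOn g (closedBall 0 1 ∩ K.charMap ρ ⁻¹' Y) ∧
      (∀ y, ‖y‖ = 1 → g y = κ (K.charMap ρ y)) ∧
      (∀ y ∈ closedBall 0 1 ∩ K.charMap ρ ⁻¹' Y, ‖g y‖ = 1) ∧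
      (z = 0 → ∀ y, ‖y‖ = 1 → g ((1 / 2 : ℝ) • y) = κ (K.charMap ρ y)) := by
  obtain ⟨k, hk, hk1, hks, hkz⟩ := aux_puncture z hz
  refine ⟨fun y => κ (K.charMap ρ (k y)), ?_, ?_, ?_, ?_⟩
  · have hsub : closedBall 0 1 ∩ K.charMap ρ ⁻¹' Y ⊆ closedBall 0 1 \ {z} := by
      rintro y ⟨hy, hyY⟩
      refine ⟨hy, ?_⟩
      rintro rfl
      exact hzY hyY
    exact (K.aux_kappa_sphere ν ρ κ hκ hρ).comp (hk.mono hsub)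
      fun y hy => by simpa using hk1 y (hsub hy)
  · intro y hy
    simp only [hks y hy]
  · intro y _
    exact hκ1 _
  · intro h y hy
    simp only
    rw [hkz h y hy]

end CWComplexCells

/-- Lemma `lem:another_cell`: if `ν ≺reg σ ≺reg τ`, then there is a
cell `σ̃ ≠ σ` with `ν ≺ σ̃ ≺ τ`. -/
theorem exists_another_cell_of_regular_facets {X : Type} [TopologicalSpace X] [T2Space X]
    (K : CWComplexCells X) (ν σ τ : K.Cell)
    (h₁ : K.RegularFacet ν σ) (h₂ : K.RegularFacet σ τ) :
    ∃ σ' : K.Cell, σ' ≠ σ ∧ K.Facet ν σ' ∧ K.Facet σ' τ := by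
  classical
  by_contra hno
  push Not at hno
  obtain ⟨κ, s, -, hκ1, hκs, hκne, hκinj, hκsurj, hκ⟩ := K.aux_kappa ν
  obtain ⟨q, hq, hq0, hqs⟩ := K.aux_q ν σ h₁ κ s hκ1 hκs hκne hκinj hκsurj hκ
  obtain ⟨j, hj, hj1, hj0, hjs⟩ := K.aux_j σ τ h₂
  have hdσ : K.dim ν + 1 = K.dim σ := h₁.2
  have hdτ : K.dim σ + 1 = K.dim τ := h₂.2
  have hjD : ∀ y, j y ∈ closedBall (0 : EuclideanSpace ℝ (Fin (K.dim τ))) 1 := by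
    intro y; simp [hj1 y]
  have hcont : ContinuousOn (fun y => K.charMap τ (j y)) (closedBall 0 1) :=
    (K.charMap_continuousOn τ).comp hj.continuousOn fun y _ => hjD y
  let Y : Set X := (fun y => K.charMap τ (j y)) '' closedBall 0 1
  have hYc : IsClosed Y := ((isCompact_closedBall _ _).image_of_continuousOn hcont).isClosed
  have hYτ : Y ⊆ K.charMap τ '' closedBall 0 1 := by
    rintro _ ⟨y, -, rfl⟩
    exact ⟨j y, hjD y, rfl⟩
  have hex : ∀ ρ : K.Cell, ∃ g : EuclideanSpace ℝ (Fin (K.dim ρ)) →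
      WithLp 2 (EuclideanSpace ℝ (Fin (K.dim ν)) × ℝ), K.dim ρ = K.dim σ →
      ContinuousOn g (closedBall 0 1 ∩ K.charMap ρ ⁻¹' Y) ∧
      (∀ y, ‖y‖ = 1 → g y = κ (K.charMap ρ y)) ∧
      (∀ y ∈ closedBall 0 1 ∩ K.charMap ρ ⁻¹' Y, ‖g y‖ = 1) ∧
      (ρ = σ → ∀ y, ‖y‖ = 1 → g ((1 / 2 : ℝ) • y) = κ (K.charMap ρ y)) := by
    intro ρ
    by_cases hd : K.dim ρ = K.dim σ
    swap
    · exact ⟨fun _ => 0, fun h => absurd h hd⟩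
    have hd' : K.dim ρ = K.dim ν + 1 := by omega
    by_cases hρσ : ρ = σ
    · subst hρσ
      obtain ⟨g, a, b, c, d⟩ := K.aux_gB ν ρ κ hκ1 hκ hd' Y 0 (by simp) (by
        rintro ⟨y, -, hy⟩
        exact hj0 y hy)
      exact ⟨g, fun _ => ⟨a, b, c, fun _ => d rfl⟩⟩
    by_cases hνρ : K.Facet ν ρ
    · have hn := hno ρ hρσ hνρ
      obtain ⟨z, hz, hzτ⟩ : ∃ z, ‖z‖ < 1 ∧ K.charMap ρ z ∉ K.charMap τ '' closedBall 0 1 := by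
        by_contra hall
        push Not at hall
        refine hn ⟨?_, by omega⟩
        rintro _ ⟨z, hz, rfl⟩
        have hz' : ‖z‖ < 1 := by simpa using hz
        refine ⟨?_, ?_⟩
        · have := hall z hz'
          rw [← K.closure_cell] at this
          exact this
        · rintro ⟨w, hw, hwz⟩
          have := K.aux_cell_eq (by simpa using hw) hz' hwz
          rw [← this] at hd
          omega
      obtain ⟨g, a, b, c, -⟩ := K.aux_gB ν ρ κ hκ1 hκ hd' Y z hz fun h => hzτ (hYτ h)
      exact ⟨g, fun _ => ⟨a, b, c, fun h => absurd h hρσ⟩⟩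
    · obtain ⟨p, hp, hpρ⟩ : ∃ p ∈ K.cellSet ν, p ∉ K.charMap ρ '' closedBall 0 1 := by
        by_contra hall
        push Not at hall
        refine hνρ ⟨?_, hd'.symm⟩
        intro p hp
        refine ⟨?_, ?_⟩
        · have := hall p hp
          rw [← K.closure_cell] at this
          exact this
        · rintro ⟨w, hw, hwp⟩
          obtain ⟨z, hz, hzp⟩ := hp
          have := K.aux_cell_eq (by simpa using hw) (by simpa using hz) (hwp.trans hzp.symm)
          rw [this] at hd'
          omega
      obtain ⟨g, a, b, c⟩ := K.aux_gA ν ρ κ s hκ1 hκs hκne hκinj hκ hd' p hp hpρ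
      exact ⟨g, fun _ => ⟨a.continuousOn, b, fun y _ => c y, fun h => absurd h hρσ⟩⟩
  choose g hg using hex
  let G : X → WithLp 2 (EuclideanSpace ℝ (Fin (K.dim ν)) × ℝ) := fun x =>
    if h : ∃ p : Σ r : K.Cell, EuclideanSpace ℝ (Fin (K.dim r)),
      K.dim p.1 = K.dim σ ∧ ‖p.2‖ < 1 ∧ K.charMap p.1 p.2 = x
    then g h.choose.1 h.choose.2 else κ x
  have G1 : ∀ (ρ : K.Cell) (y : EuclideanSpace ℝ (Fin (K.dim ρ))), K.dim ρ = K.dim σ →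
      ‖y‖ < 1 → G (K.charMap ρ y) = g ρ y := by
    intro ρ y hd hy
    have h : ∃ p : Σ r : K.Cell, EuclideanSpace ℝ (Fin (K.dim r)),
      K.dim p.1 = K.dim σ ∧ ‖p.2‖ < 1 ∧ K.charMap p.1 p.2 = K.charMap ρ y := ⟨⟨ρ, y⟩, hd, hy, rfl⟩
    have h2 : G (K.charMap ρ y) = g h.choose.1 h.choose.2 := dif_pos h
    rw [h2]
    have h3 : ∀ p : Σ r : K.Cell, EuclideanSpace ℝ (Fin (K.dim r)),
        p = ⟨ρ, y⟩ → g p.1 p.2 = g ρ y := by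
      rintro _ rfl
      rfl
    exact h3 _ (K.aux_sigma_eq h.choose_spec.2.1 hy h.choose_spec.2.2)
  have G2 : ∀ (ρ : K.Cell) (y : EuclideanSpace ℝ (Fin (K.dim ρ))), K.dim ρ < K.dim σ →
      ‖y‖ < 1 → G (K.charMap ρ y) = κ (K.charMap ρ y) := by
    intro ρ y hd hy
    refine dif_neg ?_
    rintro ⟨⟨r, w⟩, hr, hw, hwe⟩
    have h3 : r = ρ := K.aux_cell_eq hw hy hwe
    simp only at hr
    rw [h3] at hr
    omega
  have G3 : ∀ (ρ : K.Cell) (y : EuclideanSpace ℝ (Fin (K.dim ρ))), K.dim ρ = K.dim σ →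
      ‖y‖ ≤ 1 → G (K.charMap ρ y) = g ρ y := by
    intro ρ y hd hy
    rcases hy.lt_or_eq with h | h
    · exact G1 ρ y hd h
    · obtain ⟨r, w, hw, hwe⟩ := K.aux_cell_of (K.charMap ρ y)
      have h3 := K.aux_sphere_lt h hw hwe.symm
      rw [(hg ρ hd).2.1 y h, ← hwe]
      exact G2 r w (by omega) hw
  have G4 : ∀ (ρ : K.Cell) (y : EuclideanSpace ℝ (Fin (K.dim ρ))), K.dim ρ < K.dim σ →
      ‖y‖ ≤ 1 → G (K.charMap ρ y) = κ (K.charMap ρ y) := by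
    intro ρ y hd hy
    obtain ⟨r, w, hw, hwe⟩ := K.aux_cell_of (K.charMap ρ y)
    rw [← hwe]
    refine G2 r w ?_ hw
    rcases K.aux_dim_le hy hw hwe.symm with h | h
    · rw [← h]; exact hd
    · omega
  obtain ⟨I, hI, hId, hs⟩ := K.sphere_subset τ
  have hcover : Y ⊆ ⋃ ρ ∈ I, K.charMap ρ '' (closedBall 0 1 ∩ K.charMap ρ ⁻¹' Y) := by
    rintro x hx
    obtain ⟨y, -, hyx⟩ := id hx
    have h3 := hs ⟨j y, by simpa using hj1 y, hyx⟩
    simp only [mem_iUnion, exists_prop] at h3 ⊢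
    obtain ⟨ρ, hρ, w, hw, hwx⟩ := h3
    exact ⟨ρ, hρ, w, ⟨ball_subset_closedBall hw, by rw [mem_preimage, hwx]; exact hx⟩, hwx⟩
  have hGc : ContinuousOn G Y := by
    refine aux_glue I hI Y (fun ρ => closedBall 0 1 ∩ K.charMap ρ ⁻¹' Y) K.charMap G ?_ ?_ ?_ hcover
    · intro ρ _
      exact (isCompact_closedBall _ _).of_isClosed_subset
        ((K.charMap_continuousOn ρ).preimage_isClosed_of_isClosed isClosed_closedBall hYc)
        inter_subset_left
    · intro ρ _
      exact (K.charMap_continuousOn ρ).mono inter_subset_left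
    · intro ρ hρ
      have h3 := hId ρ hρ
      rcases (show K.dim ρ = K.dim σ ∨ K.dim ρ < K.dim σ by omega) with hd | hd
      · exact (hg ρ hd).1.congr fun y hy => G3 ρ y hd (mem_closedBall_zero_iff.1 hy.1)
      · have h4 : ContinuousOn κ (K.charMap ρ '' closedBall 0 1) := by
          refine hκ _ {ρ} (finite_singleton _) ?_ (by simp)
          rintro r rfl
          omega
        have h5 : ContinuousOn (fun y => κ (K.charMap ρ y)) (closedBall 0 1) :=
          h4.comp (K.charMap_continuousOn ρ) (mapsTo_image _ _)
        exact (h5.mono inter_subset_left).congr fun y hy =>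
          G4 ρ y hd (mem_closedBall_zero_iff.1 hy.1)
  have hG1 : ∀ x ∈ Y, ‖G x‖ = 1 := by
    intro x hx
    have h3 := hcover hx
    simp only [mem_iUnion, exists_prop] at h3
    obtain ⟨ρ, hρ, y, hy, rfl⟩ := h3
    have hy1 := mem_closedBall_zero_iff.1 hy.1
    have h3 := hId ρ hρ
    rcases (show K.dim ρ = K.dim σ ∨ K.dim ρ < K.dim σ by omega) with hd | hd
    · rw [G3 ρ y hd hy1]
      exact (hg ρ hd).2.2.1 y hy
    · rw [G4 ρ y hd hy1]
      exact hκ1 _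
  refine aux_zero (fun y => q (G (K.charMap τ (j y)))) ?_ ?_ ?_
  · have h3 : ContinuousOn (fun x => q (G x)) Y :=
      hq.comp hGc fun x hx => by simpa using hG1 x hx
    exact h3.comp hcont (mapsTo_image _ _)
  · intro y _
    exact hq0 _
  · intro y hy c hc
    have hhalf : ‖(1 / 2 : ℝ) • y‖ ≤ 1 := by
      rw [norm_smul, hy]
      norm_num
    show q (G (K.charMap τ (j y))) ≠ _
    rw [hjs y hy, G3 σ _ rfl hhalf, (hg σ rfl).2.2.2 rfl y hy]
    exact hqs y hy c hc
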